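/- Let u₀ : ℤ^{n-1}×{0} → ℝ be bounded. Then there exists a bounded function u₀ᴰ on ℤ^{n-1}×ℕ, with inf u₀ ≤ u₀ᴰ ≤ sup u₀, such that u₀ᴰ = u₀ on ℤ^{n-1}×{0} and Δ¹[u₀ᴰ](x) = Σ_{y∈ℤⁿ,|y|=1}(u₀ᴰ(x+y) - u₀ᴰ(x)) = 0 for all x ∈ ℤ^{n-1}×(ℕ∖{0}). -/

import Mathlib

/-- Add `s` to the `i`-th coordinate of a lattice point `x ∈ ℤ^d`. -/
def updZ (d : ℕ) (x : Fin d → ℤ) (i : Fin d) (s : ℤ) : Fin d → ℤ :=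
  fun j => x j + if j = i then s else 0

/-- The discrete Laplacian `Δ¹` on the lattice `ℤ^{d} × ℕ` at a point `(x, m)`:
the sum of the differences `w(z) - w(x,m)` over the `2(d+1)` nearest neighbors `z`. -/
def latLap (d : ℕ) (w : (Fin d → ℤ) × ℕ → ℝ) (x : Fin d → ℤ) (m : ℕ) : ℝ :=
  (∑ i : Fin d, (w (updZ d x i 1, m) + w (updZ d x i (-1), m) - 2 * w (x, m))) +
    (w (x, m + 1) + w (x, m - 1) - 2 * w (x, m))

open Classical in
/-- One averaging step with boundary data `u₀`. -/
noncomputable def avgStep (d : ℕ) (u₀ : (Fin d → ℤ) → ℝ) (w : (Fin d → ℤ) × ℕ → ℝ) :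
    (Fin d → ℤ) × ℕ → ℝ :=
  fun p => if p.2 = 0 then u₀ p.1 else
    ((∑ i : Fin d, (w (updZ d p.1 i 1, p.2) + w (updZ d p.1 i (-1), p.2))) +
      (w (p.1, p.2 + 1) + w (p.1, p.2 - 1))) / (2 * ((d : ℝ) + 1))

theorem avgStep_mono (d : ℕ) (u₀ : (Fin d → ℤ) → ℝ) : Monotone (avgStep d u₀) := by
  intro v w h p
  unfold avgStep
  split_ifs
  · exact le_rfl
  · have h1 : ∀ q, v q ≤ w q := h
    gcongr <;> apply h1

theorem avgStep_const (d : ℕ) (u₀ : (Fin d → ℤ) → ℝ) (c : ℝ) (p : (Fin d → ℤ) × ℕ) :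
    avgStep d u₀ (fun _ => c) p = if p.2 = 0 then u₀ p.1 else c := by
  unfold avgStep
  split_ifs
  · rfl
  · have : (0 : ℝ) < (d : ℝ) + 1 := by positivity
    simp only [Finset.sum_const, Finset.card_univ, Fintype.card_fin, nsmul_eq_mul]
    field_simp
    ring

theorem avgStep_le (d : ℕ) (u₀ : (Fin d → ℤ) → ℝ) (b : ℝ) (hb : ∀ z, u₀ z ≤ b)
    (w : (Fin d → ℤ) × ℕ → ℝ) (hw : ∀ p, w p ≤ b) (p : (Fin d → ℤ) × ℕ) :
    avgStep d u₀ w p ≤ b := by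
  refine (avgStep_mono d u₀ (show w ≤ fun _ => b from hw) p).trans ?_
  rw [avgStep_const]
  split_ifs
  · exact hb _
  · exact le_rfl

/-- For bounded `u₀ : ℤ^{n-1} × {0} → ℝ` there exists a bounded discrete harmonic
extension `u₀ᴰ` on `ℤ^{n-1} × ℕ`, lying between `inf u₀` and `sup u₀` (i.e. between any
pair of bounds for `u₀`), equal to `u₀` on the boundary and with `Δ¹[u₀ᴰ] = 0` at every
interior point. -/
theorem stmt_7 (d : ℕ) (u₀ : (Fin d → ℤ) → ℝ) (hb : ∃ C : ℝ, ∀ z, |u₀ z| ≤ C) :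
    ∃ w : (Fin d → ℤ) × ℕ → ℝ,
      (∀ z, w (z, 0) = u₀ z) ∧
      (∀ (x : Fin d → ℤ) (m : ℕ), 1 ≤ m → latLap d w x m = 0) ∧
      (∀ a b : ℝ, (∀ z, a ≤ u₀ z ∧ u₀ z ≤ b) → ∀ p, a ≤ w p ∧ w p ≤ b) := by 
  obtain ⟨C, hC⟩ := hb
  have hbb : BddBelow (Set.range u₀) := ⟨-C, by rintro _ ⟨z, rfl⟩; exact (abs_le.1 (hC z)).1⟩
  have hA : ∀ z, iInf u₀ ≤ u₀ z := fun z => ciInf_le hbb z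
  set T := avgStep d u₀ with hT
  set f : ℕ → (Fin d → ℤ) × ℕ → ℝ := fun k => T^[k] (fun _ => iInf u₀) with hf
  have hsucc : ∀ k, f (k + 1) = T (f k) := fun k => Function.iterate_succ_apply' _ _ _
  have h01 : f 0 ≤ f 1 := by
    intro p
    rw [hsucc 0]
    change iInf u₀ ≤ avgStep d u₀ (fun _ => iInf u₀) p
    rw [avgStep_const]
    split_ifs
    · exact hA _
    · exact le_rfl
  have hmono : Monotone f := by
    apply monotone_nat_of_le_succ
    intro k
    induction k with
    | zero => exact h01
    | succ k ih =>
      rw [hsucc k, hsucc (k + 1)]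
      exact avgStep_mono d u₀ ih
  have hub : ∀ b, (∀ z, u₀ z ≤ b) → ∀ k p, f k p ≤ b := by
    intro b hb k
    induction k with
    | zero => intro p; exact (hA 0).trans (hb 0)
    | succ k ih => rw [hsucc]; exact avgStep_le d u₀ b hb _ ih
  have hbdd : ∀ p, BddAbove (Set.range fun k => f k p) := by
    intro p
    refine ⟨C, ?_⟩
    rintro _ ⟨k, rfl⟩
    exact hub C (fun z => (abs_le.1 (hC z)).2) k p
  have hlim : ∀ p, Filter.Tendsto (fun k => f k p) Filter.atTop (nhds (⨆ k, f k p)) :=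
    fun p => tendsto_atTop_ciSup (fun i j hij => hmono hij p) (hbdd p)
  set w : (Fin d → ℤ) × ℕ → ℝ := fun p => ⨆ k, f k p with hw
  have hfix : ∀ p, w p = T w p := by
    intro p
    have h1 : Filter.Tendsto (fun k => f (k + 1) p) Filter.atTop (nhds (w p)) :=
      (hlim p).comp (Filter.tendsto_add_atTop_nat 1)
    refine tendsto_nhds_unique h1 ?_
    simp only [hsucc]
    simp only [hT, avgStep]
    split_ifs
    · exact tendsto_const_nhds
    · refine Filter.Tendsto.div_const (Filter.Tendsto.add (tendsto_finsetSum _ fun i _ => ?_) ?_) _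
      · exact (hlim _).add (hlim _)
      · exact (hlim _).add (hlim _)
  refine ⟨w, ?_, ?_, ?_⟩
  · intro z
    rw [hfix]
    simp [hT, avgStep]
  · intro x m hm
    have h := hfix (x, m)
    have hm0 : m ≠ 0 := by omega
    simp only [hT, avgStep, hm0, if_false] at h
    have hd : (0 : ℝ) < 2 * ((d : ℝ) + 1) := by positivity
    rw [eq_div_iff hd.ne'] at h
    unfold latLap
    rw [Finset.sum_sub_distrib]
    simp only [Finset.sum_const, Finset.card_univ, Fintype.card_fin, nsmul_eq_mul]
    linarith
  · intro a b hab p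
    constructor
    · exact (le_ciInf fun z => (hab z).1).trans (le_ciSup (hbdd p) 0)
    · exact ciSup_le fun k => hub b (fun z => (hab z).2) k p
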